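/- arXiv:2203.09897 — 3 statements merged into one kernel-verified Lean document; each statement's English description precedes it below -/
import Mathlib

section
/- Let A be a ring and I, J ideals with I^{n+1} ⊆ J for some n. Let M be an A-module such that M/IM is flat over A/I and Tor_k^A(M, A/I) = 0 for all k ≥ 1. Then M/JM is flat over A/J and Tor_k^A(M, A/J) = 0 for all k ≥ 1. -/
open scoped TensorProduct
open CategoryTheory CategoryTheory.Limits

section Splice

universe v u v' u'
variable {C : Type u} [Category.{v} C] [Abelian C] {D : Type u'} [Category.{v'} D] [Abelian D]

lemma ChainComplex.quasiIso_augment {S : ShortComplex C} (hS : S.ShortExact)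
    {K : ChainComplex C ℕ} (e : K.X 0 ⟶ S.X₁) [Epi e] (he : K.d 1 0 ≫ e = 0)
    (h₀ : (ShortComplex.mk _ e he).Exact)
    (hK : ∀ n, (ShortComplex.mk (K.d (n + 2) (n + 1)) (K.d (n + 1) n) (K.d_comp_d _ _ _)).Exact)
    (hf : K.d 1 0 ≫ e ≫ S.f = 0) (hg : (K.augment (e ≫ S.f) hf).d 1 0 ≫ S.g = 0) :
    QuasiIso ((ChainComplex.toSingle₀Equiv (K.augment (e ≫ S.f) hf) S.X₃).symm ⟨S.g, hg⟩) := by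
  have := hS.mono_f
  have := hS.epi_g
  have hfg : (e ≫ S.f) ≫ S.g = 0 := hg
  refine ⟨fun n => ?_⟩
  rcases n with _ | n
  · rw [ChainComplex.quasiIsoAt₀_iff, ShortComplex.quasiIso_iff_of_zeros' _ rfl rfl rfl]
    let φ : ShortComplex.mk (e ≫ S.f) S.g hfg ⟶ S := { τ₁ := e, τ₂ := 𝟙 _, τ₃ := 𝟙 _ }
    have : Epi φ.τ₁ := ‹Epi e›
    have : IsIso φ.τ₂ := inferInstanceAs (IsIso (𝟙 _))
    have : Mono φ.τ₃ := inferInstanceAs (Mono (𝟙 _))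
    refine (ShortComplex.exact_and_epi_g_iff_of_iso
      (S₂ := ShortComplex.mk (e ≫ S.f) S.g hfg) ?_).2
      ⟨(ShortComplex.exact_iff_of_epi_of_isIso_of_mono φ).2 hS.exact, hS.epi_g⟩
    exact ShortComplex.isoMk (Iso.refl _) (Iso.refl _) (Iso.refl _)
      ((Category.id_comp _).trans (Category.comp_id _).symm)
      ((Category.id_comp _).trans
        ((ChainComplex.toSingle₀Equiv_symm_apply_f_zero
          (C := K.augment (e ≫ S.f) hf) S.g hg).symm.trans (Category.comp_id _).symm))
  · rw [quasiIsoAt_iff_exactAt']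
    · rw [HomologicalComplex.exactAt_iff' _ (n + 1 + 1) (n + 1) n (by simp) (by simp)]
      rcases n with _ | n
      · let φ : ShortComplex.mk (K.d 1 0) e he ⟶ ShortComplex.mk (K.d 1 0) (e ≫ S.f) hf :=
          { τ₁ := 𝟙 _, τ₂ := 𝟙 _, τ₃ := S.f }
        have : Epi φ.τ₁ := inferInstanceAs (Epi (𝟙 _))
        have : IsIso φ.τ₂ := inferInstanceAs (IsIso (𝟙 _))
        have : Mono φ.τ₃ := ‹Mono S.f›
        exact (ShortComplex.exact_iff_of_epi_of_isIso_of_mono φ).1 h₀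
      · exact hK n
    · apply ChainComplex.exactAt_succ_single_obj

/-- A projective resolution of the kernel of an epimorphism from a projective object extends to a
projective resolution of its target. -/
noncomputable def CategoryTheory.ProjectiveResolution.splice {S : ShortComplex C}
    (hS : S.ShortExact) [Projective S.X₂] (Q : ProjectiveResolution S.X₁) :
    ProjectiveResolution S.X₃ :=
  let e : Q.complex.X 0 ⟶ S.X₁ := Q.π.f 0
  have he : Q.complex.d 1 0 ≫ e = 0 := Q.complex_d_comp_π_f_zero
  have hf : Q.complex.d 1 0 ≫ e ≫ S.f = 0 := by rw [← Category.assoc, he, zero_comp]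
  have hg : (Q.complex.augment (e ≫ S.f) hf).d 1 0 ≫ S.g = 0 :=
    (Category.assoc e S.f S.g).trans ((congrArg (e ≫ ·) S.zero).trans comp_zero)
  have : Epi e := inferInstanceAs (Epi (Q.π.f 0))
  { complex := Q.complex.augment (e ≫ S.f) hf
    projective := by
      rintro (_ | n)
      · exact ‹Projective S.X₂›
      · exact Q.projective n
    π := (ChainComplex.toSingle₀Equiv _ _).symm ⟨S.g, hg⟩
    quasiIso := ChainComplex.quasiIso_augment hS e he Q.exact₀ Q.exact_succ hf hg }

lemma CategoryTheory.ProjectiveResolution.isZero_leftDerived_succ_iff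
    [HasProjectiveResolutions C] (F : C ⥤ D) [F.Additive] {X : C} (P : ProjectiveResolution X)
    (k : ℕ) :
    IsZero ((F.leftDerived (k + 1)).obj X) ↔
      ((P.complex.sc' (k + 2) (k + 1) k).map F).Exact := by
  rw [(P.isoLeftDerivedObj F (k + 1)).isZero_iff]
  erw [← HomologicalComplex.exactAt_iff_isZero_homology]
  rw [HomologicalComplex.exactAt_iff' _ (k + 2) (k + 1) k (by simp) (by simp)]
  rfl

end Splice

universe u

section Tor

variable {A : Type u} [CommRing A] (M : Type u) [AddCommGroup M] [Module A M]

/-- The group `Tor_k(M, N)` vanishes. -/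
abbrev TorVanishes (k : ℕ) (N : Type u) [AddCommGroup N] [Module A N] : Prop :=
  IsZero (((Tor (ModuleCat A) k).obj (ModuleCat.of A M)).obj (ModuleCat.of A N))

variable {L P N : Type u} [AddCommGroup L] [Module A L] [AddCommGroup P] [Module A P]
  [AddCommGroup N] [Module A N] {i : L →ₗ[A] P} {p : P →ₗ[A] N}
   
lemma shortExact_of_exact (hi : Function.Injective i) (hip : Function.Exact i p)
    (hp : Function.Surjective p) : (ShortComplex.mk (ModuleCat.ofHom i) (ModuleCat.ofHom p)
      (ModuleCat.hom_ext hip.linearMap_comp_eq_zero)).ShortExact where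
  exact := (ShortComplex.ShortExact.moduleCat_exact_iff_function_exact _).2 hip
  mono_f := (ModuleCat.mono_iff_injective _).2 hi
  epi_g := (ModuleCat.epi_iff_surjective _).2 hp

variable [Module.Projective A P]

lemma torVanishes_add_two_iff (hi : Function.Injective i) (hip : Function.Exact i p)
    (hp : Function.Surjective p) (k : ℕ) :
    TorVanishes (A := A) M (k + 2) N ↔ TorVanishes (A := A) M (k + 1) L := by
  have hS := shortExact_of_exact hi hip hp
  have : Projective (ModuleCat.of A P) := by infer_instance
  let Q : ProjectiveResolution (ModuleCat.of A L) := projectiveResolution _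
  refine ((ProjectiveResolution.splice hS Q).isZero_leftDerived_succ_iff _ (k + 1)).trans
    (Iff.trans ?_ (Q.isZero_leftDerived_succ_iff _ k).symm)
  rfl

lemma torVanishes_one_iff (hi : Function.Injective i) (hip : Function.Exact i p)
    (hp : Function.Surjective p) :
    TorVanishes (A := A) M 1 N ↔ Function.Injective (i.lTensor M) := by
  have hS := shortExact_of_exact hi hip hp
  have : Projective (ModuleCat.of A P) := by infer_instance
  let Q : ProjectiveResolution (ModuleCat.of A L) := projectiveResolution _
  refine ((ProjectiveResolution.splice hS Q).isZero_leftDerived_succ_iff _ 0).trans ?_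
  rw [ShortComplex.ShortExact.moduleCat_exact_iff_function_exact]
  let d : Q.complex.X 1 →ₗ[A] Q.complex.X 0 := (Q.complex.d 1 0).hom
  let e : Q.complex.X 0 →ₗ[A] L := (Q.π.f 0).hom
  have h1 : Function.Exact d e :=
    (ShortComplex.ShortExact.moduleCat_exact_iff_function_exact _).1 Q.exact₀
  have h2 : Function.Surjective e := (ModuleCat.epi_iff_surjective (Q.π.f 0)).1 inferInstance
  have h3 := lTensor_exact M h1 h2
  have h4 := LinearMap.lTensor_surjective M h2
  change Function.Exact (d.lTensor M) ((i ∘ₗ e).lTensor M) ↔ _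
  rw [LinearMap.lTensor_comp]
  constructor
  · intro h
    rw [injective_iff_map_eq_zero]
    intro x hx
    obtain ⟨y, rfl⟩ := h4 x
    exact (h3 y).2 ((h y).1 hx)
  · intro h y
    rw [← h3 y]
    exact map_eq_zero_iff _ h

end Tor

section Algebra

variable {A : Type*} [CommRing A] (M : Type*) [AddCommGroup M] [Module A M]

lemma lTensor_mapRange_injective {L P : Type*} [AddCommMonoid L] [Module A L]
    [AddCommMonoid P] [Module A P] (S : Type*) {i : L →ₗ[A] P}
    (h : Function.Injective (i.lTensor M)) :
    Function.Injective
      ((Finsupp.mapRange.linearMap i : (S →₀ L) →ₗ[A] (S →₀ P)).lTensor M) := by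
  classical
  have key : (TensorProduct.finsuppRight A A M P S).toLinearMap ∘ₗ
      (Finsupp.mapRange.linearMap i : (S →₀ L) →ₗ[A] (S →₀ P)).lTensor M =
      (Finsupp.mapRange.linearMap (i.lTensor M)) ∘ₗ
        (TensorProduct.finsuppRight A A M L S).toLinearMap := by
    ext m s l : 5
    simp
  have h2 : Function.Injective (Finsupp.mapRange.linearMap (α := S) (i.lTensor M)) :=
    Finsupp.mapRange_injective _ (map_zero _) h
  refine Function.Injective.of_comp (f := TensorProduct.finsuppRight A A M P S) ?_
  have := h2.comp (TensorProduct.finsuppRight A A M L S).injective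
  exact (congr(Function.Injective $(congrArg DFunLike.coe key))).mpr this

lemma Function.Exact.finsuppMapRange {A L P N : Type*} [CommRing A] [AddCommGroup L] [Module A L]
    [AddCommGroup P] [Module A P] [AddCommGroup N] [Module A N] {i : L →ₗ[A] P} {p : P →ₗ[A] N}
    (hi : Function.Injective i) (hip : Function.Exact i p) (S : Type*) :
    Function.Exact (Finsupp.mapRange.linearMap i : (S →₀ L) →ₗ[A] (S →₀ P))
      (Finsupp.mapRange.linearMap p : (S →₀ P) →ₗ[A] (S →₀ N)) := by
  rw [LinearMap.exact_iff, Finsupp.range_mapRange_linearMap _ (LinearMap.ker_eq_bot.2 hi),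
    Finsupp.ker_mapRange, hip.linearMap_ker_eq]

lemma lTensor_baseChange_injective_iff (B : Type*) [CommRing B] [Algebra A B]
    {X Y : Type*} [AddCommGroup X] [Module A X] [Module B X] [IsScalarTower A B X]
    [AddCommGroup Y] [Module A Y] [Module B Y] [IsScalarTower A B Y] (f : X →ₗ[B] Y) :
    Function.Injective (f.lTensor (B ⊗[A] M)) ↔
      Function.Injective ((f.restrictScalars A).lTensor M) := by
  rw [LinearMap.lTensor_inj_iff_rTensor_inj, LinearMap.lTensor_inj_iff_rTensor_inj]
  let eX := TensorProduct.AlgebraTensorModule.cancelBaseChange A B B X M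
  let eY := TensorProduct.AlgebraTensorModule.cancelBaseChange A B B Y M
  have key (z) : eY (f.rTensor (B ⊗[A] M) z) = (f.restrictScalars A).rTensor M (eX z) := by
    induction z with
    | zero => simp
    | add a b ha hb => simp only [map_add, ha, hb]
    | tmul x t =>
      induction t with
      | zero => simp
      | add a b ha hb => simp only [TensorProduct.tmul_add, map_add, ha, hb]
      | tmul b m => simp [eX, eY]
  rw [← eY.injective.of_comp_iff, ← Function.Injective.of_comp_iff' _ eX.bijective]
  exact congr(Function.Injective $(funext key)).to_iff

lemma lTensor_restrictScalars_injective (B : Type*) [CommRing B] [Algebra A B]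
    [Module.Flat B (B ⊗[A] M)] {X Y : Type*} [AddCommGroup X] [Module A X] [Module B X]
    [IsScalarTower A B X] [AddCommGroup Y] [Module A Y] [Module B Y] [IsScalarTower A B Y]
    {f : X →ₗ[B] Y} (hf : Function.Injective f) :
    Function.Injective ((f.restrictScalars A).lTensor M) :=
  (lTensor_baseChange_injective_iff M B f).1
    (Module.Flat.lTensor_preserves_injective_linearMap f hf)

variable {M} in
/-- Injectivity of `M ⊗ f` from that of `M ⊗ (f ∘ j)` and `M ⊗ g`, for a commutative square
`g ∘ r = q ∘ f` whose map `r` is the cokernel of `j`. -/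
lemma lTensor_injective_of_exact {L' L L'' P Q : Type*} [AddCommGroup L'] [Module A L']
    [AddCommGroup L] [Module A L] [AddCommGroup L''] [Module A L''] [AddCommGroup P] [Module A P]
    [AddCommGroup Q] [Module A Q] {j : L' →ₗ[A] L} {r : L →ₗ[A] L''} (hjr : Function.Exact j r)
    (hr : Function.Surjective r) {f : L →ₗ[A] P} {g : L'' →ₗ[A] Q} {q : P →ₗ[A] Q}
    (h : g ∘ₗ r = q ∘ₗ f) (hg : Function.Injective (g.lTensor M))
    (hfj : Function.Injective ((f ∘ₗ j).lTensor M)) : Function.Injective (f.lTensor M) := by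
  rw [injective_iff_map_eq_zero]
  intro x hx
  have hrx : r.lTensor M x = 0 := by
    refine (map_eq_zero_iff _ hg).1 ?_
    rw [← LinearMap.lTensor_comp_apply, h, LinearMap.lTensor_comp_apply, hx, map_zero]
  obtain ⟨y, rfl⟩ := (lTensor_exact M hjr hr x).1 hrx
  rw [← LinearMap.lTensor_comp_apply] at hx
  rw [(map_eq_zero_iff _ hfj).1 hx, map_zero]

end Algebra

section Devissage

variable {A : Type u} [CommRing A] (I : Ideal A) (M : Type u) [AddCommGroup M] [Module A M]

/-- All higher `Tor` groups of `M` and `N` vanish. -/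
def TorAcyclic (N : Type u) [AddCommGroup N] [Module A N] : Prop :=
  ∀ k, TorVanishes (A := A) M (k + 1) N

/-- The smallest class of modules that contains the direct sums of copies of a `Tor`-acyclic module
and the `A ⧸ I`-modules and is closed under extensions. -/
inductive DevissageClass : ∀ (N : Type u) [AddCommGroup N] [Module A N], Prop
  | finsupp (S N : Type u) [AddCommGroup N] [Module A N] (hN : TorAcyclic (A := A) M N) :
      DevissageClass (S →₀ N)
  | quotient (N : Type u) [AddCommGroup N] [Module A N] [Module (A ⧸ I) N]
      [IsScalarTower A (A ⧸ I) N] : DevissageClass N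
  | extension {L N K : Type u} [AddCommGroup L] [Module A L] [AddCommGroup N] [Module A N]
      [AddCommGroup K] [Module A K] (i : L →ₗ[A] N) (p : N →ₗ[A] K)
      (hi : Function.Injective i) (hip : Function.Exact i p) (hp : Function.Surjective p)
      (hL : DevissageClass L) (hK : DevissageClass K) : DevissageClass N

namespace DevissageClass

variable {I M}

lemma congr {L N : Type u} [AddCommGroup L] [Module A L] [AddCommGroup N] [Module A N]
    (e : L ≃ₗ[A] N) (hL : DevissageClass I M L) : DevissageClass I M N := by
  refine extension (K := PUnit) e.toLinearMap 0 e.injective ?_ ?_ hL (quotient _)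
  · intro x
    simp
  · exact fun _ => ⟨0, rfl⟩

lemma ker_of_exact {L P N : Type u} [AddCommGroup L] [Module A L] [AddCommGroup P] [Module A P]
    [AddCommGroup N] [Module A N] {i : L →ₗ[A] P} {p : P →ₗ[A] N} (hi : Function.Injective i)
    (hip : Function.Exact i p) (hM : Function.Injective (i.lTensor M))
    (hL : DevissageClass I M L) :
    Function.Injective ((LinearMap.ker p).subtype.lTensor M) ∧
      DevissageClass I M (LinearMap.ker p) := by
  let e : L ≃ₗ[A] LinearMap.ker p :=
    (LinearEquiv.ofInjective i hi).trans (LinearEquiv.ofEq _ _ hip.linearMap_ker_eq.symm)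
  have he : (LinearMap.ker p).subtype = i ∘ₗ e.symm.toLinearMap := by
    ext1 x
    obtain ⟨y, rfl⟩ := e.surjective x
    simp [e]
  refine ⟨?_, hL.congr e⟩
  rw [he, LinearMap.lTensor_comp]
  exact hM.comp (e.symm.lTensor M).injective

variable (I M) in
/-- `N` is a quotient of a projective module by a submodule of the dévissage class whose inclusion
stays injective after tensoring with `M`. -/
def HasPresentation (N : Type u) [AddCommGroup N] [Module A N] : Prop :=
  ∃ (P : Type u) (_ : AddCommGroup P) (_ : Module A P) (p : P →ₗ[A] N),
    Module.Projective A P ∧ Function.Surjective p ∧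
      Function.Injective ((LinearMap.ker p).subtype.lTensor M) ∧
      DevissageClass I M (LinearMap.ker p)

lemma HasPresentation.of_exact {L P N : Type u} [AddCommGroup L] [Module A L] [AddCommGroup P]
    [Module A P] [Module.Projective A P] [AddCommGroup N] [Module A N] {i : L →ₗ[A] P}
    {p : P →ₗ[A] N} (hi : Function.Injective i) (hip : Function.Exact i p)
    (hp : Function.Surjective p) (hM : Function.Injective (i.lTensor M))
    (hL : DevissageClass I M L) : HasPresentation I M N :=
  ⟨P, inferInstance, inferInstance, p, inferInstance, hp, ker_of_exact hi hip hM hL⟩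

lemma finsupp_of_exact {L P N : Type u} [AddCommGroup L] [Module A L] [AddCommGroup P]
    [Module A P] [Module.Projective A P] [AddCommGroup N] [Module A N] {i : L →ₗ[A] P}
    {p : P →ₗ[A] N} (hi : Function.Injective i) (hip : Function.Exact i p)
    (hp : Function.Surjective p) (S : Type u) (hN : TorAcyclic (A := A) M N) :
    Function.Injective
      ((Finsupp.mapRange.linearMap i : (S →₀ L) →ₗ[A] (S →₀ P)).lTensor M) ∧
      DevissageClass I M (S →₀ L) :=
  ⟨lTensor_mapRange_injective M S ((torVanishes_one_iff M hi hip hp).1 (hN 0)),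
    finsupp S L fun k => (torVanishes_add_two_iff M hi hip hp k).1 (hN (k + 1))⟩

lemma hasPresentation_finsupp (S N : Type u) [AddCommGroup N] [Module A N]
    (hN : TorAcyclic (A := A) M N) : HasPresentation I M (S →₀ N) := by
  let p := Finsupp.linearCombination A (id : N → N)
  have hp : Function.Surjective p := Finsupp.linearCombination_id_surjective A N
  have hi : Function.Injective (LinearMap.ker p).subtype := Submodule.subtype_injective _
  have hip := LinearMap.exact_subtype_ker_map p
  obtain ⟨hM, hC⟩ := finsupp_of_exact (I := I) (L := LinearMap.ker p) (P := N →₀ A) hi hip hp S hN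
  exact .of_exact (Finsupp.mapRange_injective _ (map_zero _) hi) (hip.finsuppMapRange hi S)
    (Finsupp.mapRange_surjective _ (map_zero _) hp) hM hC

/-- A presentation `0 → K → Q → N → 0` over a quotient of `A` lifts along a surjection `P → Q` with
projective source and kernel `L` to a presentation over `A`. -/
lemma HasPresentation.of_comp {L P K Q N : Type u} [AddCommGroup L] [Module A L]
    [AddCommGroup P] [Module A P] [Module.Projective A P] [AddCommGroup K] [Module A K]
    [AddCommGroup Q] [Module A Q] [AddCommGroup N] [Module A N] {k : K →ₗ[A] Q}
    {j : L →ₗ[A] P} {q : P →ₗ[A] Q} {p : Q →ₗ[A] N} (hj : Function.Injective j)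
    (hjq : Function.Exact j q) (hq : Function.Surjective q) (hp : Function.Surjective p)
    (hjM : Function.Injective (j.lTensor M)) (hL : DevissageClass I M L)
    (hk : Function.Injective k) (hkp : Function.Exact k p)
    (hkM : Function.Injective (k.lTensor M)) (hK : DevissageClass I M K) :
    HasPresentation I M N := by
  obtain ⟨hpM, hpC⟩ := ker_of_exact hk hkp hkM hK
  let i : L →ₗ[A] LinearMap.ker (p ∘ₗ q) := j.codRestrict _ fun x => by
    rw [LinearMap.mem_ker, LinearMap.comp_apply, hjq.apply_apply_eq_zero, map_zero]
  let r : LinearMap.ker (p ∘ₗ q) →ₗ[A] LinearMap.ker p :=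
    (q ∘ₗ (LinearMap.ker (p ∘ₗ q)).subtype).codRestrict _ fun x => x.2
  have hi : Function.Injective i := fun x y h => hj congr(($h : P))
  have hir : Function.Exact i r := by
    rintro ⟨x, hx⟩
    constructor
    · intro h
      obtain ⟨y, rfl⟩ := (hjq x).1 congr(($h : Q))
      exact ⟨y, rfl⟩
    · rintro ⟨y, hy⟩
      obtain rfl : j y = x := congr(($hy : P))
      exact Subtype.ext (hjq.apply_apply_eq_zero y)
  have hr : Function.Surjective r := by
    rintro ⟨y, hy⟩
    obtain ⟨x, rfl⟩ := hq y
    exact ⟨⟨x, hy⟩, rfl⟩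
  exact ⟨P, inferInstance, inferInstance, p ∘ₗ q, inferInstance, hp.comp hq,
    lTensor_injective_of_exact hir hr (f := Submodule.subtype _) (q := q) rfl hpM hjM,
    extension i r hi hir hr hL hpC⟩

lemma hasPresentation_quotient (hflat : Module.Flat (A ⧸ I) ((A ⧸ I) ⊗[A] M))
    (htor : TorAcyclic (A := A) M (A ⧸ I))
    (N : Type u) [AddCommGroup N] [Module A N] [Module (A ⧸ I) N] [IsScalarTower A (A ⧸ I) N] :
    HasPresentation I M N := by
  have hi : Function.Injective (Submodule.subtype I) := Subtype.val_injective
  have hip : Function.Exact (Submodule.subtype I) (Submodule.mkQ I) :=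
    LinearMap.exact_subtype_mkQ I
  have hp := Submodule.mkQ_surjective I
  obtain ⟨hM, hC⟩ := finsupp_of_exact (I := I) hi hip hp N htor
  let p := Finsupp.linearCombination (A ⧸ I) (id : N → N)
  have hk : Function.Injective (((LinearMap.ker p).subtype.restrictScalars A).lTensor M) :=
    lTensor_restrictScalars_injective M (A ⧸ I) (Submodule.subtype_injective _)
  exact .of_comp (p := p.restrictScalars A) (Finsupp.mapRange_injective _ (map_zero _) hi)
    (hip.finsuppMapRange hi N) (Finsupp.mapRange_surjective _ (map_zero _) hp)
    (Finsupp.linearCombination_id_surjective (A ⧸ I) N) hM hC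
    (k := (LinearMap.ker p).subtype.restrictScalars A) (Submodule.subtype_injective _)
    (LinearMap.exact_subtype_ker_map p) hk
    (quotient (LinearMap.ker p))

lemma hasPresentation (hflat : Module.Flat (A ⧸ I) ((A ⧸ I) ⊗[A] M))
    (htor : TorAcyclic (A := A) M (A ⧸ I))
    {N : Type u} [AddCommGroup N] [Module A N] (hN : DevissageClass I M N) :
    HasPresentation I M N := by
  induction hN with
  | finsupp S N hN => exact hasPresentation_finsupp S N hN
  | quotient N => exact hasPresentation_quotient hflat htor N
  | @extension L N K _ _ _ _ _ _ i p hi hip hp _ _ ihL ihK =>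
    obtain ⟨P, _, _, f, _, hf, hfM, hfC⟩ := ihL
    obtain ⟨Q, _, _, g, _, hg, hgM, hgC⟩ := ihK
    obtain ⟨l, hl⟩ := Module.projective_lifting_property p g hp
    have hl' (b) : p (l b) = g b := congr($hl b)
    have hpi (a) : p (i a) = 0 := hip.apply_apply_eq_zero a
    let h : P × Q →ₗ[A] N := (i ∘ₗ f).coprod l
    let j : LinearMap.ker f →ₗ[A] LinearMap.ker h :=
      (LinearMap.inl A P Q ∘ₗ (LinearMap.ker f).subtype).codRestrict _ fun x => by
        simp [h]
    let r : LinearMap.ker h →ₗ[A] LinearMap.ker g :=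
      (LinearMap.snd A P Q ∘ₗ (LinearMap.ker h).subtype).codRestrict _ fun x => by
        have hx : i (f x.1.1) + l x.1.2 = 0 := x.2
        have := congrArg p hx
        rw [map_add, hpi, hl', zero_add, map_zero] at this
        exact this
    have hj : Function.Injective j := fun x y hxy => by
      have : (x : P) = y := congr(($hxy : P × Q).1)
      exact Subtype.ext this
    have hjr : Function.Exact j r := by
      rintro ⟨⟨a, b⟩, hx⟩
      have hx' : i (f a) + l b = 0 := hx
      constructor
      · intro h0
        obtain rfl : b = 0 := congr(($h0 : Q))
        rw [map_zero, add_zero] at hx'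
        exact ⟨⟨a, (map_eq_zero_iff _ hi).1 hx'⟩, rfl⟩
      · rintro ⟨y, hy⟩
        have : (0 : Q) = b := congr(($hy : P × Q).2)
        exact Subtype.ext this.symm
    have hr : Function.Surjective r := by
      rintro ⟨b, hb⟩
      obtain ⟨y, hy⟩ := (hip (l b)).1 ((hl' b).trans hb)
      obtain ⟨a, rfl⟩ := hf y
      refine ⟨⟨(-a, b), ?_⟩, rfl⟩
      simp [h, hy]
    refine ⟨P × Q, inferInstance, inferInstance, h, inferInstance, ?_, ?_,
      extension j r hj hjr hr hfC hgC⟩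
    · intro n
      obtain ⟨b, hb⟩ := hg (p n)
      obtain ⟨y, hy⟩ := (hip (n - l b)).1 (by rw [map_sub, hl', hb, sub_self])
      obtain ⟨a, rfl⟩ := hf y
      exact ⟨(a, b), by simp [h, hy]⟩
    · refine lTensor_injective_of_exact hjr hr (f := Submodule.subtype _) (q := LinearMap.snd A P Q)
        rfl hgM ?_
      refine .of_comp (f := (LinearMap.fst A P Q).lTensor M) ?_
      rwa [← LinearMap.coe_comp, ← LinearMap.lTensor_comp]

lemma torAcyclic (hflat : Module.Flat (A ⧸ I) ((A ⧸ I) ⊗[A] M))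
    (htor : TorAcyclic (A := A) M (A ⧸ I))
    {N : Type u} [AddCommGroup N] [Module A N] (hN : DevissageClass I M N) :
    TorAcyclic (A := A) M N := by
  intro k
  induction k generalizing N with
  | zero =>
    obtain ⟨P, _, _, p, _, hp, hM, -⟩ := hasPresentation hflat htor hN
    exact (torVanishes_one_iff M Subtype.val_injective
      (LinearMap.exact_subtype_ker_map p) hp).2 hM
  | succ k ih =>
    obtain ⟨P, _, _, p, _, hp, -, hC⟩ := hasPresentation hflat htor hN
    exact (torVanishes_add_two_iff M Subtype.val_injective
      (LinearMap.exact_subtype_ker_map p) hp k).2 (ih hC)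

lemma of_isTorsionBySet_pow (n : ℕ) (N : Type u) [AddCommGroup N] [Module A N]
    (hN : Module.IsTorsionBySet A N (I ^ n : Ideal A)) : DevissageClass I M N := by
  induction n generalizing N with
  | zero =>
    have hN' : Module.IsTorsionBySet A N (I : Set A) := fun x a => hN (x := x) (a := ⟨a, by simp⟩)
    let _ := hN'.module
    have : IsScalarTower A (A ⧸ I) N := hN'.isScalarTower
    exact quotient N
  | succ n ih =>
    refine extension (Submodule.subtype (I • ⊤ : Submodule A N)) (Submodule.mkQ _)
      Subtype.val_injective (LinearMap.exact_subtype_mkQ _) (Submodule.mkQ_surjective _)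
      (ih _ ?_) (quotient _)
    rintro ⟨x, hx⟩ ⟨a, ha⟩
    refine Subtype.ext ?_
    change a • x = 0
    induction hx using Submodule.smul_induction_on' with
    | smul b hb y _ =>
      rw [smul_smul]
      exact hN (x := y) (a := ⟨a * b, by rw [pow_succ]; exact Ideal.mul_mem_mul ha hb⟩)
    | add x _ y _ hx hy => rw [smul_add, hx, hy, add_zero]

end DevissageClass

variable {M} in
/-- An injection with `Tor`-acyclic cokernel stays injective after tensoring. -/
lemma TorAcyclic.lTensor_injective {L N K : Type u} [AddCommGroup L] [Module A L]
    [AddCommGroup N] [Module A N] [AddCommGroup K] [Module A K]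
    (hK : TorAcyclic (A := A) M K) {i : L →ₗ[A] N} {p : N →ₗ[A] K}
    (hi : Function.Injective i) (hip : Function.Exact i p) (hp : Function.Surjective p) :
    Function.Injective (i.lTensor M) := by
  let g := Finsupp.linearCombination A (id : N → N)
  have hg : Function.Surjective g := Finsupp.linearCombination_id_surjective A N
  have hge := LinearMap.exact_subtype_ker_map g
  have hpgs : Function.Surjective (p ∘ₗ g) := hp.comp hg
  have h1 := (torVanishes_one_iff M (Submodule.subtype_injective _)
    (LinearMap.exact_subtype_ker_map (p ∘ₗ g)) hpgs).1 (hK 0)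
  let e := LinearEquiv.ofInjective i hi
  have hpg (x : LinearMap.ker (p ∘ₗ g)) : g x ∈ LinearMap.range i := (hip _).1 x.2
  let s : LinearMap.ker (p ∘ₗ g) →ₗ[A] L :=
    e.symm.toLinearMap ∘ₗ (g ∘ₗ Submodule.subtype _).codRestrict _ hpg
  have his : i ∘ₗ s = g ∘ₗ Submodule.subtype _ := by
    ext1 x
    exact congrArg Subtype.val (e.apply_symm_apply ⟨g x, hpg x⟩)
  have hs : Function.Surjective s := by
    intro y
    obtain ⟨x, hx⟩ := hg (i y)
    have hx' : (p ∘ₗ g) x = 0 := by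
      rw [LinearMap.comp_apply, hx, hip.apply_apply_eq_zero]
    exact ⟨⟨x, hx'⟩, hi ((congr($his ⟨x, hx'⟩)).trans hx)⟩
  let t : LinearMap.ker g →ₗ[A] LinearMap.ker (p ∘ₗ g) :=
    Submodule.inclusion fun x hx => by
      rw [LinearMap.mem_ker, LinearMap.comp_apply, hx, map_zero]
  have hst : s ∘ₗ t = 0 := by
    ext1 x
    exact hi ((congr($his (t x))).trans (x.2.trans (map_zero i).symm))
  rw [injective_iff_map_eq_zero]
  intro x hx
  obtain ⟨y, rfl⟩ := LinearMap.lTensor_surjective M hs x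
  rw [← LinearMap.lTensor_comp_apply, his, LinearMap.lTensor_comp_apply] at hx
  obtain ⟨z, hz⟩ := (lTensor_exact (M := LinearMap.ker g) M hge hg _).1 hx
  have : t.lTensor M z = y := h1 (by rw [← LinearMap.lTensor_comp_apply, ← hz]; rfl)
  rw [← this, ← LinearMap.lTensor_comp_apply, hst, LinearMap.lTensor_zero, LinearMap.zero_apply]

end Devissage

/-- Complete flatness passes from an ideal `I` to any ideal `J` containing a power of `I`:
if `M/IM` is flat over `A/I` and `Tor_k^A(M, A/I) = 0` for `k ≥ 1`, and `I^(n+1) ⊆ J`,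
then `M/JM` is flat over `A/J` and `Tor_k^A(M, A/J) = 0` for `k ≥ 1`. -/
theorem stmt7 (A : Type) [CommRing A] (M : Type) [AddCommGroup M] [Module A M]
    (I J : Ideal A) (n : ℕ) (hIJ : I ^ (n + 1) ≤ J)
    (hflat : Module.Flat (A ⧸ I) ((A ⧸ I) ⊗[A] M))
    (htor : ∀ k : ℕ, 1 ≤ k →
      IsZero (((Tor (ModuleCat A) k).obj (ModuleCat.of A M)).obj (ModuleCat.of A (A ⧸ I)))) :
    Module.Flat (A ⧸ J) ((A ⧸ J) ⊗[A] M) ∧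
      ∀ k : ℕ, 1 ≤ k →
        IsZero (((Tor (ModuleCat A) k).obj (ModuleCat.of A M)).obj
          (ModuleCat.of A (A ⧸ J))) := by
  have hI : TorAcyclic (A := A) M (A ⧸ I) := fun k => htor (k + 1) k.succ_pos
  have key (N : Type) [AddCommGroup N] [Module A N] [Module (A ⧸ J) N]
      [IsScalarTower A (A ⧸ J) N] : TorAcyclic (A := A) M N := by
    refine (DevissageClass.of_isTorsionBySet_pow (n + 1) N ?_).torAcyclic hflat hI
    rintro x ⟨a, ha⟩
    change a • x = 0
    rw [← algebraMap_smul (A ⧸ J) a x, Ideal.Quotient.algebraMap_eq,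
      Ideal.Quotient.eq_zero_iff_mem.2 (hIJ ha), zero_smul]
  refine ⟨Module.Flat.iff_lTensor_injective'.2 fun 𝔞 => ?_, fun k hk => ?_⟩
  · rw [lTensor_baseChange_injective_iff]
    exact (key ((A ⧸ J) ⧸ 𝔞)).lTensor_injective Subtype.val_injective
      (p := (Submodule.mkQ 𝔞).restrictScalars A) (LinearMap.exact_subtype_mkQ 𝔞)
      (Submodule.mkQ_surjective 𝔞)
  · obtain ⟨k, rfl⟩ := Nat.exists_eq_add_of_le' hk
    exact key (A ⧸ J) k
end

section
/- Let A be a ring, I = (f) a principal ideal, and M an A-module with M/IM flat over A/I and Tor_k^A(M, A/I) = 0 for k ≥ 1 (i.e. M is completely flat for the I-adic topology). Then for every A/I-module N, Tor_k^A(M, N) = 0 for all k ≥ 1 and M ⊗_A N is naturally isomorphic to (M/IM) ⊗_{A/I} N. -/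
open scoped TensorProduct
open CategoryTheory CategoryTheory.Limits

open Function in
/-- Diagram chase for a short exact sequence of complexes `A → B → C` with `B` exact: exactness of
`C` in degree two is a condition on `A` in degree one. -/
theorem exact_iff_of_shortExact_of_exact {R : Type*} [CommRing R]
    {A₂ A₁ A₀ B₃ B₂ B₁ B₀ C₃ C₂ C₁ : Type*}
    [AddCommGroup A₂] [AddCommGroup A₁] [AddCommGroup A₀] [AddCommGroup B₃] [AddCommGroup B₂]
    [AddCommGroup B₁] [AddCommGroup B₀] [AddCommGroup C₃] [AddCommGroup C₂] [AddCommGroup C₁]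
    [Module R A₂] [Module R A₁] [Module R A₀] [Module R B₃] [Module R B₂]
    [Module R B₁] [Module R B₀] [Module R C₃] [Module R C₂] [Module R C₁]
    {a₂ : A₂ →ₗ[R] A₁} {a₁ : A₁ →ₗ[R] A₀}
    {b₃ : B₃ →ₗ[R] B₂} {b₂ : B₂ →ₗ[R] B₁} {b₁ : B₁ →ₗ[R] B₀}
    {c₃ : C₃ →ₗ[R] C₂} {c₂ : C₂ →ₗ[R] C₁}
    {k₂ : A₂ →ₗ[R] B₂} {k₁ : A₁ →ₗ[R] B₁} {k₀ : A₀ →ₗ[R] B₀}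
    {p₃ : B₃ →ₗ[R] C₃} {p₂ : B₂ →ₗ[R] C₂} {p₁ : B₁ →ₗ[R] C₁}
    (hb₃ : Exact b₃ b₂) (hb₂ : Exact b₂ b₁)
    (hk₁ : Injective k₁) (hp₃ : Surjective p₃) (hp₂ : Surjective p₂)
    (he₂ : Exact k₂ p₂) (he₁ : Exact k₁ p₁)
    (hka₂ : ∀ x, k₁ (a₂ x) = b₂ (k₂ x)) (hka₁ : ∀ x, k₀ (a₁ x) = b₁ (k₁ x))
    (hpb₃ : ∀ x, p₂ (b₃ x) = c₃ (p₃ x)) (hpb₂ : ∀ x, p₁ (b₂ x) = c₂ (p₂ x)) :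
    Exact c₃ c₂ ↔ ∀ x, k₀ (a₁ x) = 0 → x ∈ Set.range a₂ := by
  constructor
  · intro h x hx
    obtain ⟨y, hy⟩ := (hb₂ (k₁ x)).1 (by rw [← hka₁, hx])
    obtain ⟨z, hz⟩ := (h (p₂ y)).1 (by rw [← hpb₂, hy, he₁.apply_apply_eq_zero])
    obtain ⟨w, rfl⟩ := hp₃ z
    obtain ⟨v, hv⟩ := (he₂ (y - b₃ w)).1 (by rw [map_sub, hpb₃, hz, sub_self])
    exact ⟨v, hk₁ (by rw [hka₂, hv, map_sub, hb₃.apply_apply_eq_zero, sub_zero, hy])⟩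
  · intro h y
    constructor
    · intro hy
      obtain ⟨u, rfl⟩ := hp₂ y
      obtain ⟨x, hx⟩ := (he₁ (b₂ u)).1 (by rw [hpb₂, hy])
      obtain ⟨v, rfl⟩ := h x (by rw [hka₁, hx, hb₂.apply_apply_eq_zero])
      obtain ⟨w, hw⟩ := (hb₃ (u - k₂ v)).1 (by rw [map_sub, ← hka₂, hx, sub_self])
      exact ⟨p₃ w, by rw [← hpb₃, hw, map_sub, he₂.apply_apply_eq_zero, sub_zero]⟩
    · rintro ⟨z, rfl⟩
      obtain ⟨w, rfl⟩ := hp₃ z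
      rw [← hpb₃, ← hpb₂, hb₃.apply_apply_eq_zero, map_zero]

section ExactSequence

variable {R : Type*} [CommRing R] {M M' L Q₃ Q₂ Q₁ Q₀ : Type*}
  [AddCommGroup M] [AddCommGroup M'] [AddCommGroup L]
  [AddCommGroup Q₃] [AddCommGroup Q₂] [AddCommGroup Q₁] [AddCommGroup Q₀]
  [Module R M] [Module R M'] [Module R L]
  [Module R Q₃] [Module R Q₂] [Module R Q₁] [Module R Q₀]
  {k : M' →ₗ[R] L} {p : L →ₗ[R] M}
  {d₃ : Q₃ →ₗ[R] Q₂} {d₂ : Q₂ →ₗ[R] Q₁} {d₁ : Q₁ →ₗ[R] Q₀}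

open Function

theorem lTensor_exact_iff_of_flat [Module.Flat R L] [Module.Flat R Q₁]
    (hk : Injective k) (hp : Surjective p) (hkp : Exact k p)
    (h₃ : Exact d₃ d₂) (h₂ : Exact d₂ d₁) :
    Exact (d₃.lTensor M) (d₂.lTensor M) ↔
      ∀ x, k.rTensor Q₀ (d₁.lTensor M' x) = 0 → x ∈ Set.range (d₂.lTensor M') := by
  refine exact_iff_of_shortExact_of_exact (k₂ := k.rTensor Q₂) (k₁ := k.rTensor Q₁)
    (p₃ := p.rTensor Q₃) (p₂ := p.rTensor Q₂) (p₁ := p.rTensor Q₁)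
    (Module.Flat.lTensor_exact L h₃) (Module.Flat.lTensor_exact L h₂)
    (Module.Flat.rTensor_preserves_injective_linearMap k hk)
    (LinearMap.rTensor_surjective _ hp) (LinearMap.rTensor_surjective _ hp)
    (rTensor_exact _ hkp hp) (rTensor_exact _ hkp hp) ?_ ?_ ?_ ?_ <;>
  · intro x
    simp only [← LinearMap.comp_apply, LinearMap.rTensor_comp_lTensor,
      LinearMap.lTensor_comp_rTensor]

/-- Dimension shifting in the first tensor factor. -/
theorem lTensor_exact_iff_lTensor_exact_of_flat [Module.Flat R L] [Module.Flat R Q₁]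
    [Module.Flat R Q₀] (hk : Injective k) (hp : Surjective p) (hkp : Exact k p)
    (h₃ : Exact d₃ d₂) (h₂ : Exact d₂ d₁) :
    Exact (d₃.lTensor M) (d₂.lTensor M) ↔ Exact (d₂.lTensor M') (d₁.lTensor M') := by
  rw [lTensor_exact_iff_of_flat hk hp hkp h₃ h₂]
  have hinj : Injective (k.rTensor Q₀) := Module.Flat.rTensor_preserves_injective_linearMap k hk
  refine ⟨fun h x ↦ ⟨fun hx ↦ h x (by rw [hx, map_zero]), ?_⟩, fun h x hx ↦ (h x).1 ?_⟩
  · rintro ⟨y, rfl⟩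
    rw [← LinearMap.comp_apply, ← LinearMap.lTensor_comp, h₂.linearMap_comp_eq_zero,
      LinearMap.lTensor_zero, LinearMap.zero_apply]
  · exact hinj (by rw [hx, map_zero])

theorem lTensor_exact_iff_rTensor_injective_of_flat [Module.Flat R L] [Module.Flat R Q₁]
    (hk : Injective k) (hp : Surjective p) (hkp : Exact k p)
    (h₃ : Exact d₃ d₂) (h₂ : Exact d₂ d₁) (h₁ : Surjective d₁) :
    Exact (d₃.lTensor M) (d₂.lTensor M) ↔ Injective (k.rTensor Q₀) := by
  rw [lTensor_exact_iff_of_flat hk hp hkp h₃ h₂, injective_iff_map_eq_zero]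
  have hex := lTensor_exact M' h₂ h₁
  refine ⟨fun h y hy ↦ ?_, fun h x hx ↦ (hex x).1 (h _ hx)⟩
  obtain ⟨x, rfl⟩ := LinearMap.lTensor_surjective M' h₁ y
  exact (hex x).2 (h x hy)

end ExactSequence

section Flat

/-- Every module is the quotient of a flat module. -/
theorem Module.exists_shortExact_flat.{v, w} (R : Type v) [CommRing R] (M : Type w) [AddCommGroup M]
    [Module R M] :
    ∃ (M' L : Type (max v w)) (_ : AddCommGroup M') (_ : AddCommGroup L) (_ : Module R M')
      (_ : Module R L) (_ : Module.Flat R L) (k : M' →ₗ[R] L) (p : L →ₗ[R] M),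
      Function.Injective k ∧ Function.Surjective p ∧ Function.Exact k p := by
  let p : (M →₀ R) →ₗ[R] M := Finsupp.linearCombination R id
  exact ⟨p.ker, M →₀ R, inferInstance, inferInstance, inferInstance, inferInstance, inferInstance,
    p.ker.subtype, p, p.ker.subtype_injective,
    Finsupp.linearCombination_surjective R Function.surjective_id, LinearMap.exact_subtype_ker_map p⟩

/-- The kernel of a surjection of flat modules is flat. -/
theorem Module.Flat.of_shortExact {R : Type*} [CommRing R] {M' L M : Type*}
    [AddCommGroup M'] [AddCommGroup L] [AddCommGroup M] [Module R M'] [Module R L] [Module R M]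
    [Module.Flat R L] [Module.Flat R M] {k : M' →ₗ[R] L} {p : L →ₗ[R] M}
    (hk : Function.Injective k) (hp : Function.Surjective p) (hkp : Function.Exact k p) : Module.Flat R M' := by
  rw [Module.Flat.iff_rTensor_injective']
  intro J
  have hL : Function.Injective (J.subtype.rTensor L) :=
    Module.Flat.rTensor_preserves_injective_linearMap _ J.subtype_injective
  have hJ : Function.Injective (k.lTensor J) :=
    LinearMap.lTensor_injective_of_exact_of_flat p hp k hk hkp J
  have : k.lTensor R ∘ₗ J.subtype.rTensor M' = J.subtype.rTensor L ∘ₗ k.lTensor J := by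
    rw [LinearMap.rTensor_comp_lTensor, LinearMap.lTensor_comp_rTensor]
  refine Function.Injective.of_comp (f := k.lTensor R) ?_
  rw [← LinearMap.coe_comp, this, LinearMap.coe_comp]
  exact hL.comp hJ

/-- If `k` stays injective after base change to `S` and has flat cokernel there, then it stays
injective after tensoring with any `S`-module. -/
theorem LinearMap.rTensor_injective_of_flat_baseChange {R S : Type*} [CommRing R] [CommRing S]
    [Algebra R S] {M' L M : Type*} [AddCommGroup M'] [AddCommGroup L] [AddCommGroup M]
    [Module R M'] [Module R L] [Module R M] [Module.Flat S (S ⊗[R] M)]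
    {k : M' →ₗ[R] L} {p : L →ₗ[R] M} (hp : Function.Surjective p) (hkp : Function.Exact k p)
    (hk : Function.Injective (k.baseChange S)) (P : Type*) [AddCommGroup P] [Module R P] [Module S P]
    [IsScalarTower R S P] : Function.Injective (k.rTensor P) := by
  have hS : Function.Injective ((k.baseChange S).lTensor P) :=
    LinearMap.lTensor_injective_of_exact_of_flat (p.baseChange S)
      (LinearMap.lTensor_surjective S hp) _ hk (lTensor_exact S hkp hp) P
  have hcomm := TensorProduct.AlgebraTensorModule.lTensor_comp_cancelBaseChange R S S (M := P) k
  rw [← LinearMap.lTensor_inj_iff_rTensor_inj]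
  intro x y hxy
  let e := TensorProduct.AlgebraTensorModule.cancelBaseChange R S S P M'
  refine e.symm.injective (hS ((TensorProduct.AlgebraTensorModule.cancelBaseChange R S S P L).injective ?_))
  have h (z) := DFunLike.congr_fun hcomm (e.symm z)
  simp only [LinearMap.comp_apply, LinearEquiv.coe_coe, e, LinearEquiv.apply_symm_apply] at h
  exact (h x).symm.trans (hxy.trans (h y))

end Flat

section Tor

universe u

variable {R : Type u} [CommRing R]

instance CategoryTheory.ProjectiveResolution.flat_X {X : ModuleCat.{u} R} (Q : ProjectiveResolution X) (n : ℕ) :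
    Module.Flat R (Q.complex.X n) :=
  have : Module.Projective R (Q.complex.X n) := inferInstance
  inferInstance

theorem CategoryTheory.ProjectiveResolution.exact_hom_d {X : ModuleCat.{u} R} (Q : ProjectiveResolution X)
    (n : ℕ) :
    Function.Exact (Q.complex.d (n + 2) (n + 1)).hom (Q.complex.d (n + 1) n).hom :=
  (ShortComplex.ShortExact.moduleCat_exact_iff_function_exact _).1 (Q.exact_succ n)

theorem isZero_Tor_succ_iff (M X : ModuleCat.{u} R) (Q : ProjectiveResolution X) (n : ℕ) :
    IsZero (((Tor (ModuleCat R) (n + 1)).obj M).obj X) ↔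
      Function.Exact ((Q.complex.d (n + 2) (n + 1)).hom.lTensor M)
        ((Q.complex.d (n + 1) n).hom.lTensor M) := by
  rw [Tor_obj, (Q.isoLeftDerivedObj _ (n + 1)).isZero_iff]
  refine (HomologicalComplex.exactAt_iff_isZero_homology _ _).symm.trans ?_
  rw [HomologicalComplex.exactAt_iff' _ (n + 2) (n + 1) n (by simp) (by simp),
    ShortComplex.ShortExact.moduleCat_exact_iff_function_exact]
  rfl

variable {M M' L : Type u} [AddCommGroup M] [AddCommGroup M'] [AddCommGroup L]
  [Module R M] [Module R M'] [Module R L] [Module.Flat R L]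
  {k : M' →ₗ[R] L} {p : L →ₗ[R] M}

open Function

/-- Dimension shifting for `Tor` in the first variable. -/
theorem isZero_Tor_succ_succ_iff (hk : Injective k) (hp : Surjective p) (hkp : Exact k p)
    (X : ModuleCat.{u} R) (n : ℕ) :
    IsZero (((Tor (ModuleCat R) (n + 2)).obj (ModuleCat.of R M)).obj X) ↔
      IsZero (((Tor (ModuleCat R) (n + 1)).obj (ModuleCat.of R M')).obj X) := by
  let Q := ProjectiveResolution.of X
  rw [isZero_Tor_succ_iff _ X Q, isZero_Tor_succ_iff _ X Q]
  exact lTensor_exact_iff_lTensor_exact_of_flat hk hp hkp (Q.exact_hom_d (n + 1)) (Q.exact_hom_d n)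

theorem isZero_Tor_one_iff (hk : Injective k) (hp : Surjective p) (hkp : Exact k p)
    (X : ModuleCat.{u} R) :
    IsZero (((Tor (ModuleCat R) 1).obj (ModuleCat.of R M)).obj X) ↔
      Injective (k.rTensor X) := by
  let Q := ProjectiveResolution.of X
  rw [isZero_Tor_succ_iff _ X Q]
  exact lTensor_exact_iff_rTensor_injective_of_flat hk hp hkp (Q.exact_hom_d 0)
    (d₁ := (Q.π.f 0).hom)
    ((ShortComplex.ShortExact.moduleCat_exact_iff_function_exact _).1 Q.exact₀)
    ((ModuleCat.epi_iff_surjective (Q.π.f 0)).1 inferInstance)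

end Tor

/-- If `S ⊗ M` is flat over `S` and `Tor_k(M, S) = 0` for `k ≥ 1`, then `Tor_k(M, P) = 0` for
`k ≥ 1` and every `S`-module `P`. -/
theorem isZero_Tor_succ_of_flat_of_isZero_Tor_succ.{u} {R S P : Type u} [CommRing R] [CommRing S]
    [Algebra R S] [AddCommGroup P] [Module R P] [Module S P] [IsScalarTower R S P] (n : ℕ)
    (M : Type u) [AddCommGroup M] [Module R M] (hflat : Module.Flat S (S ⊗[R] M))
    (htor : ∀ k : ℕ, IsZero (((Tor (ModuleCat R) (k + 1)).obj (ModuleCat.of R M)).obj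
      (ModuleCat.of R S))) :
    IsZero (((Tor (ModuleCat R) (n + 1)).obj (ModuleCat.of R M)).obj (ModuleCat.of R P)) := by
  induction n generalizing M with
  | zero =>
    obtain ⟨M', L, _, _, _, _, _, k, p, hk, hp, hkp⟩ := Module.exists_shortExact_flat R M
    have hS : Function.Injective (k.baseChange S) :=
      (LinearMap.lTensor_inj_iff_rTensor_inj S k).2
        ((isZero_Tor_one_iff hk hp hkp (ModuleCat.of R S)).1 (htor 0))
    exact (isZero_Tor_one_iff hk hp hkp (ModuleCat.of R P)).2
      (LinearMap.rTensor_injective_of_flat_baseChange hp hkp hS P)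
  | succ n ih =>
    obtain ⟨M', L, _, _, _, _, _, k, p, hk, hp, hkp⟩ := Module.exists_shortExact_flat R M
    have hS : Function.Injective (k.baseChange S) :=
      (LinearMap.lTensor_inj_iff_rTensor_inj S k).2
        ((isZero_Tor_one_iff hk hp hkp (ModuleCat.of R S)).1 (htor 0))
    have hflat' : Module.Flat S (S ⊗[R] M') :=
      Module.Flat.of_shortExact hS (p := p.baseChange S) (LinearMap.lTensor_surjective S hp)
        (lTensor_exact S hkp hp)
    have htor' (j : ℕ) := (isZero_Tor_succ_succ_iff hk hp hkp (ModuleCat.of R S) j).1 (htor (j + 1))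
    refine (isZero_Tor_succ_succ_iff hk hp hkp (ModuleCat.of R P) n).2 ?_
    exact ih M' hflat' htor'

/-- If `I = (f)` is principal and `M` is completely flat for the `I`-adic topology
(`M/IM` flat over `A/I` and `Tor_k^A(M, A/I) = 0` for `k ≥ 1`), then for every
`A/I`-module `P` (viewed as an `A`-module via `A → A/I`) one has `Tor_k^A(M, P) = 0` for
`k ≥ 1` and `M ⊗_A P ≅ (M/IM) ⊗_{A/I} P`. -/
theorem stmt8 (A : Type) [CommRing A] (M : Type) [AddCommGroup M] [Module A M]
    (I : Ideal A) (f : A) (hI : I = Ideal.span {f})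
    (hflat : Module.Flat (A ⧸ I) ((A ⧸ I) ⊗[A] M))
    (htor : ∀ k : ℕ, 1 ≤ k →
      IsZero (((Tor (ModuleCat A) k).obj (ModuleCat.of A M)).obj (ModuleCat.of A (A ⧸ I))))
    (P : Type) [AddCommGroup P] [Module A P] [Module (A ⧸ I) P]
    [IsScalarTower A (A ⧸ I) P] :
    (∀ k : ℕ, 1 ≤ k →
      IsZero (((Tor (ModuleCat A) k).obj (ModuleCat.of A M)).obj (ModuleCat.of A P))) ∧
    Nonempty ((M ⊗[A] P) ≃ₗ[A]
      RestrictScalars A (A ⧸ I) (((A ⧸ I) ⊗[A] M) ⊗[A ⧸ I] P)) := by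
  refine ⟨fun k hk ↦ ?_, ⟨?_⟩⟩
  · obtain ⟨n, rfl⟩ := Nat.exists_eq_add_of_le' hk
    exact isZero_Tor_succ_of_flat_of_isZero_Tor_succ (S := A ⧸ I) n M hflat
      fun j ↦ htor (j + 1) (Nat.le_add_left 1 j)
  · exact TensorProduct.comm A M P ≪≫ₗ
      ((TensorProduct.AlgebraTensorModule.cancelBaseChange A (A ⧸ I) (A ⧸ I) P M).symm ≪≫ₗ
        TensorProduct.comm (A ⧸ I) P ((A ⧸ I) ⊗[A] M)).restrictScalars A
end

section
/- Let R be an adic ring with finitely generated ideal of definition I, and let B → C be a morphism of I-adically complete R-algebras which is formally faithfully flat (i.e. faithfully flat modulo I^n for all n). Then an I-adically complete B-module M is finite projective if and only if the completed base change C ⊗̂_B M is a finite projective C-module. -/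
open scoped TensorProduct

/-- Finite projectivity of modules descends along faithfully flat ring extensions. -/
theorem Module.finite_and_projective_of_faithfullyFlat_tensorProduct
    (R T M : Type*) [CommRing R] [CommRing T] [Algebra R T] [AddCommGroup M] [Module R M]
    [Module.FaithfullyFlat R T] [Module.Finite T (T ⊗[R] M)] [Module.Projective T (T ⊗[R] M)] :
    Module.Finite R M ∧ Module.Projective R M := by
  have hfin : Module.Finite R M := .of_finite_tensorProduct_of_faithfullyFlat T
  refine ⟨hfin, ?_⟩
  have hflat : Module.Flat R M := .of_flat_tensorProduct R M T
  obtain ⟨n, f, hf⟩ := Module.Finite.exists_fin' R M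
  have hfT : Function.Surjective (f.baseChange T) := LinearMap.lTensor_surjective T hf
  have hexact : Function.Exact (f.ker.subtype.baseChange T) (f.baseChange T) :=
    Module.Flat.lTensor_exact T (LinearMap.exact_subtype_ker_map f)
  have hinj : Function.Injective (f.ker.subtype.baseChange T) :=
    Module.Flat.lTensor_preserves_injective_linearMap (M := T) _ f.ker.injective_subtype
  have : Module.FinitePresentation T (T ⊗[R] M) := Module.finitePresentation_of_projective _ _
  have hker : (f.baseChange T).ker.FG := Module.FinitePresentation.fg_ker _ hfT
  rw [LinearMap.exact_iff.mp hexact] at hker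
  have : Module.Finite T (f.ker.subtype.baseChange T).range := .of_fg hker
  have : Module.Finite T (T ⊗[R] f.ker) :=
    .equiv (LinearEquiv.ofInjective _ hinj).symm
  have : Module.Finite R f.ker := .of_finite_tensorProduct_of_faithfullyFlat T
  have : Module.FinitePresentation R M :=
    Module.finitePresentation_of_surjective f hf (Module.Finite.iff_fg.mp this)
  exact Module.Flat.projective_of_finitePresentation

/-- A base change that kills an ideal `I` does not see surjections with kernel inside `I • ⊤`. -/
theorem LinearMap.baseChange_bijective_of_ker_le_smul
    {R A X Q : Type*} [CommRing R] [CommRing A] [Algebra R A]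
    [AddCommGroup X] [Module R X] [AddCommGroup Q] [Module R Q]
    {I : Ideal R} (hI : ∀ x ∈ I, algebraMap R A x = 0) {g : X →ₗ[R] Q}
    (hg : Function.Surjective g) (hker : g.ker ≤ I • ⊤) :
    Function.Bijective (g.baseChange A) := by
  refine ⟨?_, LinearMap.lTensor_surjective A hg⟩
  have hexact : Function.Exact (g.ker.subtype.lTensor A) (g.lTensor A) :=
    _root_.lTensor_exact A (LinearMap.exact_subtype_ker_map g) hg
  have hkill (a : A) (x : X) (hx : x ∈ (I • ⊤ : Submodule R X)) : a ⊗ₜ[R] x = 0 := by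
    induction hx using Submodule.smul_induction_on' with
    | smul r hr x _ => rw [← TensorProduct.smul_tmul, Algebra.smul_def, hI r hr]; simp
    | add x _ y _ hx hy => rw [TensorProduct.tmul_add, hx, hy, add_zero]
  have hzero : g.ker.subtype.lTensor A = 0 := by
    ext a x
    simpa using hkill a x (hker x.2)
  rw [injective_iff_map_eq_zero]
  intro y hy
  obtain ⟨z, rfl⟩ := (hexact y).mp hy
  simp [hzero]

/-- A module whose reduction modulo `I` is projective has the lifting property with respect to
surjections out of modules killed by `I`. -/
theorem Module.exists_comp_eq_of_projective_quotient_tensorProduct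
    {B M Q Q' : Type*} [CommRing B] [AddCommGroup M] [Module B M]
    [AddCommGroup Q] [Module B Q] [AddCommGroup Q'] [Module B Q'] (I : Ideal B)
    [Module.Projective (B ⧸ I) ((B ⧸ I) ⊗[B] M)] (hQ : Module.IsTorsionBySet B Q I)
    (g : Q →ₗ[B] Q') (f : M →ₗ[B] Q') (hfg : f.range ≤ g.range) :
    ∃ h : M →ₗ[B] Q, g ∘ₗ h = f := by
  have hr : Module.IsTorsionBySet B g.range I := by
    rintro ⟨_, x, rfl⟩ a
    ext
    simpa using congr(g $(@hQ x a))
  let _ := hQ.module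
  let _ := hr.module
  let g' : Q →ₗ[B ⧸ I] g.range :=
    g.rangeRestrict.extendScalarsOfSurjective Ideal.Quotient.mk_surjective
  let f' : M →ₗ[B] g.range := f.codRestrict _ fun x ↦ hfg ⟨x, rfl⟩
  have hg' : Function.Surjective g' := g.surjective_rangeRestrict
  obtain ⟨h, hh⟩ := Module.projective_lifting_property g' (f'.liftBaseChange (B ⧸ I)) hg'
  refine ⟨(h.restrictScalars B) ∘ₗ TensorProduct.mk B (B ⧸ I) M 1, ?_⟩
  ext x
  have := congr((($hh (1 ⊗ₜ x) : g.range) : Q'))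
  simpa [g', f'] using this

/-- `AdicCompletion.of` is bijective on finite projective modules over a complete ring. -/
theorem IsAdicComplete.of_finite_projective {B M : Type*} [CommRing B] (I : Ideal B)
    [IsAdicComplete I B] [AddCommGroup M] [Module B M] [Module.Finite B M]
    [Module.Projective B M] : IsAdicComplete I M := by
  obtain ⟨n, f, hf⟩ := Module.Finite.exists_fin' B M
  obtain ⟨s, hs⟩ := Module.projective_lifting_property f LinearMap.id hf
  have hpi : (AdicCompletion.piEquivFin I n) ∘ AdicCompletion.of I (Fin n → B) =
      Pi.map fun _ ↦ AdicCompletion.of I B := by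
    ext x i : 2
    exact congr_fun (AdicCompletion.piEquivFin_apply I n _) i
  have hbij : Function.Bijective (AdicCompletion.of I (Fin n → B)) := by
    rw [← (AdicCompletion.piEquivFin I n).bijective.of_comp_iff', hpi]
    exact .piMap fun _ ↦ AdicCompletion.of_bijective I B
  have hsf (x : M) : f (s x) = x := congr($hs x)
  refine AdicCompletion.of_bijective_iff.mp ⟨fun x y hxy ↦ ?_, fun y ↦ ?_⟩
  · have : s x = s y := hbij.1 (by rw [← AdicCompletion.map_of, hxy, AdicCompletion.map_of])
    rw [← hsf x, this, hsf]
  · obtain ⟨z, hz⟩ := hbij.2 (AdicCompletion.map I s y)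
    refine ⟨f z, ?_⟩
    rw [← AdicCompletion.map_of, hz, AdicCompletion.map_comp_apply, hs, AdicCompletion.map_id,
      LinearMap.id_apply]

/-- Given a surjection `f : N → M` with `M ⧸ J ^ (n + 1)` projective, a section of `f` modulo
`J ^ n` lifts to a section modulo `J ^ (n + 1)`. -/
theorem LinearMap.exists_lift_reduceModIdeal_pow_succ
    {B N M : Type*} [CommRing B] [AddCommGroup N] [Module B N] [AddCommGroup M] [Module B M]
    (f : N →ₗ[B] M) (J : Ideal B) (n : ℕ) (hf : Function.Surjective f)
    (hM : Module.Projective (B ⧸ J ^ (n + 1)) ((B ⧸ J ^ (n + 1)) ⊗[B] M))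
    (t : M →ₗ[B] N ⧸ (J ^ n • ⊤ : Submodule B N))
    (ht : ∀ x, f.reduceModIdeal (J ^ n) (t x) = Submodule.Quotient.mk x) :
    ∃ t' : M →ₗ[B] N ⧸ (J ^ (n + 1) • ⊤ : Submodule B N),
      (∀ x, f.reduceModIdeal (J ^ (n + 1)) (t' x) = Submodule.Quotient.mk x) ∧
      Submodule.factorPow J N n.le_succ ∘ₗ t' = t := by
  have htors :
      Module.IsTorsionBySet B (N ⧸ (J ^ (n + 1) • ⊤ : Submodule B N)) (J ^ (n + 1) :) := by
    intro x a
    obtain ⟨y, rfl⟩ := Submodule.Quotient.mk_surjective _ x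
    rw [← Submodule.Quotient.mk_smul, Submodule.Quotient.mk_eq_zero]
    exact Submodule.smul_mem_smul a.2 trivial
  obtain ⟨t', ht'⟩ := Module.exists_comp_eq_of_projective_quotient_tensorProduct (J ^ (n + 1))
    htors (((f.reduceModIdeal (J ^ (n + 1))).restrictScalars B).prod
      (Submodule.factorPow J N n.le_succ)) ((Submodule.mkQ _).prod t) (by
      rintro _ ⟨x, rfl⟩
      obtain ⟨y, hy⟩ := Submodule.Quotient.mk_surjective _ (t x)
      have hxy : x - f y ∈ (J ^ n • ⊤ : Submodule B M) := by
        rw [← Submodule.Quotient.eq, ← ht x, ← hy, reduceModIdeal_apply]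
      rw [← LinearMap.range_eq_top.mpr hf, LinearMap.range_eq_map, ← Submodule.map_smul''] at hxy
      obtain ⟨z, hz, hzx⟩ := hxy
      refine ⟨Submodule.Quotient.mk (y + z), Prod.ext ?_ ?_⟩
      · change Submodule.Quotient.mk (f (y + z)) = Submodule.Quotient.mk x
        rw [map_add, hzx, add_sub_cancel]
      · change Submodule.Quotient.mk (y + z) = t x
        rw [← hy, Submodule.Quotient.eq]
        simpa using hz)
  exact ⟨t', fun x ↦ congr(($ht' x).1), LinearMap.ext fun x ↦ congr(($ht' x).2)⟩

/-- A complete module over a complete ring is finite projective as soon as all its reductions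
modulo powers of the ideal are. -/
theorem IsAdicComplete.finite_and_projective_of_quotient_pow
    {B M : Type*} [CommRing B] (J : Ideal B)
    [IsAdicComplete J B] [AddCommGroup M] [Module B M] [IsAdicComplete J M]
    (hM : ∀ n, Module.Finite (B ⧸ J ^ n) ((B ⧸ J ^ n) ⊗[B] M) ∧
      Module.Projective (B ⧸ J ^ n) ((B ⧸ J ^ n) ⊗[B] M)) :
    Module.Finite B M ∧ Module.Projective B M := by
  have hfinJ : Module.Finite B (M ⧸ (J • ⊤ : Submodule B M)) := by
    have := (hM 1).1
    have : Module.Finite B ((B ⧸ J ^ 1) ⊗[B] M) := .trans (B ⧸ J ^ 1) _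
    have := Module.Finite.equiv (TensorProduct.quotTensorEquivQuotSMul M (J ^ 1))
    rwa [pow_one] at this
  obtain ⟨k, p, hp⟩ := Module.Finite.exists_fin' B (M ⧸ (J • ⊤ : Submodule B M))
  obtain ⟨f, hf⟩ := Module.projective_lifting_property (J • ⊤ : Submodule B M).mkQ p
    (Submodule.mkQ_surjective _)
  have : IsAdicComplete J (Fin k → B) := .of_finite_projective J
  have hfsurj : Function.Surjective f :=
    surjective_of_mkQ_comp_surjective (I := J) (by rw [hf]; exact hp)
  refine ⟨.of_surjective f hfsurj, ?_⟩
  choose next hnext hcompat using fun n ↦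
    f.exists_lift_reduceModIdeal_pow_succ J n hfsurj (hM (n + 1)).2
  let t (n : ℕ) : { t : M →ₗ[B] (Fin k → B) ⧸ (J ^ n • ⊤ : Submodule B (Fin k → B)) //
      ∀ x, f.reduceModIdeal (J ^ n) (t x) = Submodule.Quotient.mk x } :=
    Nat.rec ⟨0, fun x ↦ by
      rw [LinearMap.zero_apply, map_zero, eq_comm, Submodule.Quotient.mk_eq_zero]
      simp⟩ (fun n t ↦ ⟨next n t.1 t.2, hnext n t.1 t.2⟩) n
  have ht {m n : ℕ} (hmn : m ≤ n) : Submodule.factorPow J _ hmn ∘ₗ (t n).1 = (t m).1 :=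
    IsAdicComplete.StrictMono.factorPow_comp_eq_of_factorPow_comp_succ_eq strictMono_id
      (fun n ↦ (t n).1) (fun {m} ↦ hcompat m (t m).1 (t m).2) hmn
  refine .of_split (IsAdicComplete.lift J (fun n ↦ (t n).1) ht) f ?_
  apply DFunLike.coe_injective
  refine IsHausdorff.funext J fun n x ↦ ?_
  have := (t n).2 x
  rwa [← IsAdicComplete.mk_lift J ht] at this

/-- Finite projectivity of a completion passes to the base change to any algebra killed by a power
of the ideal. -/
theorem AdicCompletion.finite_and_projective_tensorProduct
    {C A X : Type*} [CommRing C] [CommRing A] [Algebra C A] [AddCommGroup X] [Module C X]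
    {K : Ideal C} (hK : K.FG) (n : ℕ) (hA : ∀ x ∈ K ^ n, algebraMap C A x = 0)
    [Module.Finite C (AdicCompletion K X)] [Module.Projective C (AdicCompletion K X)] :
    Module.Finite A (A ⊗[C] X) ∧ Module.Projective A (A ⊗[C] X) := by
  let e₁ := LinearEquiv.ofBijective _ (LinearMap.baseChange_bijective_of_ker_le_smul hA
    (AdicCompletion.eval_surjective K X n) (AdicCompletion.pow_smul_top_eq_ker_eval hK).ge)
  let e₂ := LinearEquiv.ofBijective _ (LinearMap.baseChange_bijective_of_ker_le_smul hA
    (Submodule.mkQ_surjective (K ^ n • ⊤ : Submodule C X)) (Submodule.ker_mkQ _).le)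
  exact ⟨.equiv (e₁.trans e₂.symm), .of_equiv (e₁.trans e₂.symm)⟩

/-- Faithfully flat descent of finite projectivity along a formally faithfully flat
morphism `B → C` of `I`-adically complete `R`-algebras: an `I`-adically complete
`B`-module `M` is finite projective iff its completed base change `C ⊗̂_B M` is a
finite projective `C`-module. -/
theorem stmt9 (R B C M : Type*) [CommRing R] [CommRing B] [CommRing C]
    [Algebra R B] [Algebra R C] [Algebra B C] [IsScalarTower R B C]
    [AddCommGroup M] [Module B M]
    (I : Ideal R) (hfg : I.FG)
    (hBc : IsAdicComplete (I.map (algebraMap R B)) B)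
    (hCc : IsAdicComplete (I.map (algebraMap R C)) C)
    (hff : ∀ n : ℕ, Module.FaithfullyFlat (B ⧸ (I.map (algebraMap R B)) ^ n)
      ((B ⧸ (I.map (algebraMap R B)) ^ n) ⊗[B] C))
    (hMc : IsAdicComplete (I.map (algebraMap R B)) M) :
    (Module.Finite B M ∧ Module.Projective B M) ↔
      (Module.Finite C (AdicCompletion (I.map (algebraMap R C)) (C ⊗[B] M)) ∧
        Module.Projective C (AdicCompletion (I.map (algebraMap R C)) (C ⊗[B] M))) := by
  constructor
  · rintro ⟨_, _⟩
    have : IsAdicComplete (I.map (algebraMap R C)) (C ⊗[B] M) := .of_finite_projective _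
    let e := AdicCompletion.ofLinearEquiv (I.map (algebraMap R C)) (C ⊗[B] M)
    exact ⟨.equiv e, .of_equiv e⟩
  · rintro ⟨_, _⟩
    refine IsAdicComplete.finite_and_projective_of_quotient_pow (I.map (algebraMap R B)) fun n ↦ ?_
    let J := I.map (algebraMap R B) ^ n
    let A := (B ⧸ J) ⊗[B] C
    let _ : Algebra C A := Algebra.TensorProduct.rightAlgebra
    have : Module.FaithfullyFlat (B ⧸ J) A := hff n
    have hA : ∀ x ∈ I.map (algebraMap R C) ^ n, algebraMap C A x = 0 := by
      suffices I.map (algebraMap R C) ^ n ≤ RingHom.ker (algebraMap C A) from this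
      rw [IsScalarTower.algebraMap_eq R B C, ← Ideal.map_map, ← Ideal.map_pow,
        Ideal.map_le_iff_le_comap]
      intro b hb
      rw [Ideal.mem_comap, RingHom.mem_ker, ← IsScalarTower.algebraMap_apply B C A,
        IsScalarTower.algebraMap_apply B (B ⧸ J) A, Ideal.Quotient.algebraMap_eq,
        Ideal.Quotient.eq_zero_iff_mem.mpr hb, map_zero]
    obtain ⟨_, _⟩ := AdicCompletion.finite_and_projective_tensorProduct (A := A)
      (X := C ⊗[B] M) (hfg.map _) n hA
    let e : A ⊗[C] (C ⊗[B] M) ≃ₗ[A] A ⊗[B ⧸ J] ((B ⧸ J) ⊗[B] M) :=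
      (TensorProduct.AlgebraTensorModule.cancelBaseChange B C A A M).trans
        (TensorProduct.AlgebraTensorModule.cancelBaseChange B (B ⧸ J) A A M).symm
    have : Module.Finite A (A ⊗[B ⧸ J] ((B ⧸ J) ⊗[B] M)) := .equiv e
    have : Module.Projective A (A ⊗[B ⧸ J] ((B ⧸ J) ⊗[B] M)) := .of_equiv e
    exact Module.finite_and_projective_of_faithfullyFlat_tensorProduct (B ⧸ J) A _
end
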